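/- With G, d, T, gᵢ as in the context, let 𝒞₆ be the smallest 𝔽₃-subspace of G that contains g₀, g₁, g₂, g₃, g₄, g₅ and is closed under the ternary operation T. Then 𝒞₆ has 𝔽₃-dimension 220. -/

import Mathlib

/-- The Grassmann (exterior) algebra over `𝔽₃` of the free module with basis
indexed by `ℕ × ℕ`. -/
abbrev Gr : Type := ExteriorAlgebra (ZMod 3) ((ℕ × ℕ) →₀ ZMod 3)

/-- The generator `i^{(j)}` of the Grassmann algebra, i.e. `ι(e_{i,j})`. -/
noncomputable abbrev gen (i j : ℕ) : Gr :=
  ExteriorAlgebra.ι (ZMod 3) (Finsupp.single (i, j) (1 : ZMod 3))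

/-- `gᵢ = ι(e_{i,0})`. -/
noncomputable abbrev g (i : ℕ) : Gr := gen i 0

namespace Grassmann

/-! ### Derivations of exterior algebras -/

/-- Every endomorphism of a module extends to an (even) derivation of its exterior algebra. -/
theorem exists_derivation {R M : Type*} [CommRing R] [AddCommGroup M] [Module R M]
    (f : M →ₗ[R] M) :
    ∃ D : ExteriorAlgebra R M →ₗ[R] ExteriorAlgebra R M,
      (∀ u v, D (u * v) = D u * v + u * D v) ∧
        ∀ m, D (ExteriorAlgebra.ι R m) = ExteriorAlgebra.ι R (f m) := by
  let φ : M →ₗ[R] TrivSqZeroExt (ExteriorAlgebra R M) (ExteriorAlgebra R M) :=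
    (TrivSqZeroExt.inlAlgHom R _ _).toLinearMap ∘ₗ ExteriorAlgebra.ι R +
      (TrivSqZeroExt.inrHom _ _).restrictScalars R ∘ₗ ExteriorAlgebra.ι R ∘ₗ f
  have hφ (m : M) : φ m = TrivSqZeroExt.inl (ExteriorAlgebra.ι R m) +
      TrivSqZeroExt.inr (ExteriorAlgebra.ι R (f m)) := rfl
  have hsq (m : M) : φ m * φ m = 0 := by
    rw [hφ]
    ext
    · simp
    · simpa [-ExteriorAlgebra.ι_add_mul_swap] using ExteriorAlgebra.ι_add_mul_swap (R := R) m (f m)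
  let F := ExteriorAlgebra.lift R ⟨φ, hsq⟩
  have hF (m : M) : F (ExteriorAlgebra.ι R m) = φ m := ExteriorAlgebra.lift_ι_apply _ _ _ _
  have hfst (u : ExteriorAlgebra R M) : (F u).fst = u := by
    have : (TrivSqZeroExt.fstHom R _ _).comp F = AlgHom.id R (ExteriorAlgebra R M) := by
      refine ExteriorAlgebra.hom_ext (LinearMap.ext fun m => ?_)
      change (F (ExteriorAlgebra.ι R m)).fst = ExteriorAlgebra.ι R m
      simp [hF, hφ]
    exact congrArg (fun h : ExteriorAlgebra R M →ₐ[R] ExteriorAlgebra R M => h u) this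
  refine ⟨(TrivSqZeroExt.sndHom _ _).restrictScalars R ∘ₗ F.toLinearMap, fun u v => ?_,
    fun m => ?_⟩
  · change (F (u * v)).snd = (F u).snd * v + u * (F v).snd
    rw [map_mul, TrivSqZeroExt.snd_mul, hfst, hfst, smul_eq_mul, op_smul_eq_mul,
      add_comm]
  · change (F (ExteriorAlgebra.ι R m)).snd = _
    simp [hF, hφ]

theorem derivation_one {A : Type*} [Ring A] {D : A → A}
    (hD : ∀ u v, D (u * v) = D u * v + u * D v) : D 1 = 0 := by
  simpa using hD 1 1

/-! ### Monomials -/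

/-- The `n`-th letter: the `(n / 6)`-th derivative of the generator of index `n % 6`. -/
noncomputable def letter (n : ℕ) : Gr := gen (n % 6) (n / 6)

/-- The product of the letters in a list. -/
noncomputable def mono (l : List ℕ) : Gr := (l.map letter).prod

/-- The total order of differentiation of a list of letters. -/
def order (l : List ℕ) : ℕ := (l.map (· / 6)).sum

@[simp] theorem mono_nil : mono [] = 1 := rfl

@[simp] theorem mono_cons (n : ℕ) (l : List ℕ) : mono (n :: l) = letter n * mono l := by
  simp [mono]

theorem mono_append (l m : List ℕ) : mono (l ++ m) = mono l * mono m := by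
  simp [mono]

@[simp] theorem order_nil : order [] = 0 := rfl

@[simp] theorem order_cons (n : ℕ) (l : List ℕ) : order (n :: l) = n / 6 + order l := by
  simp [order]

theorem order_append (l m : List ℕ) : order (l ++ m) = order l + order m := by
  simp [order]

theorem letter_mul_self (n : ℕ) : letter n * letter n = 0 :=
  ExteriorAlgebra.ι_sq_zero _

theorem letter_mul_swap (m n : ℕ) : letter m * letter n = -(letter n * letter m) :=
  eq_neg_of_add_eq_zero_left (ExteriorAlgebra.ι_add_mul_swap _ _)

theorem mono_perm {l m : List ℕ} (h : l.Perm m) : mono l = mono m ∨ mono l = -mono m := by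
  induction h with
  | nil => simp
  | cons n _ ih => rcases ih with ih | ih <;> simp [ih]
  | swap a b l =>
    right
    simp only [mono_cons, ← mul_assoc, letter_mul_swap b a, neg_mul]
  | trans _ _ ih₁ ih₂ => rcases ih₁ with h₁ | h₁ <;> rcases ih₂ with h₂ | h₂ <;> simp [h₁, h₂]

theorem mono_eq_zero_of_not_nodup {l : List ℕ} (h : ¬l.Nodup) : mono l = 0 := by
  obtain ⟨n, hn⟩ := List.exists_duplicate_iff_not_nodup.mpr h
  obtain ⟨m, hm⟩ := (List.duplicate_iff_sublist.mp hn).exists_perm_append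
  have h₀ : mono ([n, n] ++ m) = 0 := by simp [← mul_assoc, letter_mul_self]
  rcases mono_perm hm with h | h <;> simp only [h, h₀, neg_zero]

/-- The span of the monomials with `k` letters and total order `s`. -/
noncomputable def homogeneous (k s : ℕ) : Submodule (ZMod 3) Gr :=
  Submodule.span (ZMod 3) (mono '' {l | l.length = k ∧ order l = s})

theorem mono_mem_homogeneous (l : List ℕ) : mono l ∈ homogeneous l.length (order l) :=
  Submodule.subset_span ⟨l, ⟨rfl, rfl⟩, rfl⟩

theorem homogeneous_mul_le (k s k' s' : ℕ) :
    homogeneous k s * homogeneous k' s' ≤ homogeneous (k + k') (s + s') := by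
  rw [homogeneous, homogeneous, Submodule.span_mul_span, Submodule.span_le]
  rintro _ ⟨_, ⟨l, ⟨rfl, rfl⟩, rfl⟩, _, ⟨m, ⟨rfl, rfl⟩, rfl⟩, rfl⟩
  simpa [mono_append, order_append] using mono_mem_homogeneous (l ++ m)

theorem letter_mul_mem_homogeneous (n : ℕ) {k s : ℕ} {u : Gr} (hu : u ∈ homogeneous k s) :
    letter n * u ∈ homogeneous (k + 1) (n / 6 + s) := by
  have := homogeneous_mul_le 1 (n / 6) k s
    (Submodule.mul_mem_mul (by simpa using mono_mem_homogeneous [n]) hu)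
  rwa [add_comm 1 k] at this

theorem derivation_mem_homogeneous {d : Gr →ₗ[ZMod 3] Gr}
    (hLeib : ∀ u v : Gr, d (u * v) = d u * v + u * d v)
    (hd : ∀ n, d (letter n) = letter (n + 6)) {k s : ℕ} {u : Gr}
    (hu : u ∈ homogeneous k s) : d u ∈ homogeneous k (s + 1) := by
  suffices h : homogeneous k s ≤ (homogeneous k (s + 1)).comap d from h hu
  clear hu
  rw [homogeneous, Submodule.span_le]
  rintro _ ⟨l, ⟨rfl, rfl⟩, rfl⟩
  rw [SetLike.mem_coe, Submodule.mem_comap]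
  induction l with
  | nil => simp [derivation_one hLeib]
  | cons n l ih =>
    rw [mono_cons, hLeib, hd]
    refine add_mem ?_ ?_
    · have := letter_mul_mem_homogeneous (n + 6) (mono_mem_homogeneous l)
      rwa [Nat.add_div_right n (by norm_num), Nat.succ_add] at this
    · have := letter_mul_mem_homogeneous n ih
      rwa [← add_assoc] at this

/-- A derivation `E` lowering the order of differentiation, normalised so that the commutator of
`E` and `d` acts on a monomial with `k` letters and order `s` as the scalar `k - 2 * s`. -/
theorem exists_lowering : ∃ E : Gr →ₗ[ZMod 3] Gr,
    (∀ u v : Gr, E (u * v) = E u * v + u * E v) ∧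
      ∀ n, E (letter n) = ((n / 6 : ℕ) * (2 - (n / 6 : ℕ)) : ZMod 3) • letter (n - 6) := by
  obtain ⟨E, hE, hι⟩ := exists_derivation (R := ZMod 3)
    (Finsupp.linearCombination (ZMod 3) fun p : ℕ × ℕ =>
      ((p.2 : ZMod 3) * (2 - (p.2 : ZMod 3))) • Finsupp.single (p.1, p.2 - 1) (1 : ZMod 3))
  refine ⟨E, hE, fun n => ?_⟩
  rw [letter, hι, letter]
  rcases lt_or_ge n 6 with h | h
  · simp [Nat.div_eq_of_lt h]
  · have h₁ : (n - 6) % 6 = n % 6 := by omega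
    have h₂ : (n - 6) / 6 = n / 6 - 1 := by omega
    rw [h₁, h₂, Finsupp.linearCombination_single, one_smul, map_smul]

theorem lowering_comp_derivation {d E : Gr →ₗ[ZMod 3] Gr}
    (hLeib : ∀ u v : Gr, d (u * v) = d u * v + u * d v)
    (hd : ∀ n, d (letter n) = letter (n + 6))
    (hE : ∀ u v : Gr, E (u * v) = E u * v + u * E v)
    (hEl : ∀ n, E (letter n) = ((n / 6 : ℕ) * (2 - (n / 6 : ℕ)) : ZMod 3) • letter (n - 6))
    {k s : ℕ} {u : Gr} (hu : u ∈ homogeneous k s) :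
    E (d u) = d (E u) + ((k : ZMod 3) - 2 * s) • u := by
  suffices h : homogeneous k s ≤
      LinearMap.eqLocus (E ∘ₗ d) (d ∘ₗ E + ((k : ZMod 3) - 2 * s) • LinearMap.id) from h hu
  clear hu
  have hletter (n : ℕ) :
      E (d (letter n)) = d (E (letter n)) + (1 - 2 * (n / 6 : ℕ) : ZMod 3) • letter n := by
    rw [hd, hEl, hEl, map_smul, hd]
    rcases lt_or_ge n 6 with h | h
    · have h₁ : (n + 6) / 6 = 1 := by omega
      norm_num [Nat.div_eq_of_lt h, h₁]
    · rw [Nat.sub_add_cancel h, Nat.add_sub_cancel, ← add_smul, Nat.add_div_right n (by norm_num)]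
      congr 1
      push_cast
      ring
  rw [homogeneous, Submodule.span_le]
  rintro _ ⟨l, ⟨rfl, rfl⟩, rfl⟩
  change E (d (mono l)) = d (E (mono l)) + ((l.length : ZMod 3) - 2 * order l) • mono l
  induction l with
  | nil => simp [derivation_one hLeib, derivation_one hE]
  | cons n l ih =>
    simp only [mono_cons, hLeib, hE, map_add, ih, hletter, List.length_cons, order_cons, add_mul,
      mul_add, smul_mul_assoc, mul_smul_comm]
    push_cast
    module

/-! ### Coefficients of monomials -/

/-- The coefficient of the increasing monomial with set of letters `s`. -/
noncomputable def coeff (s : Finset ℕ) : Gr →ₗ[ZMod 3] ZMod 3 :=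
  (Finsupp.basisSingleOne (R := ZMod 3) (ι := ℕ)).ExteriorAlgebra.coord s ∘ₗ
    (ExteriorAlgebra.map (Finsupp.linearCombination (ZMod 3) fun p : ℕ × ℕ =>
      Finsupp.single (6 * p.2 + p.1) (1 : ZMod 3))).toLinearMap

theorem coeff_mono {l : List ℕ} (hl : l.SortedLT) (s : Finset ℕ) :
    coeff s (mono l) = if l.toFinset = s then 1 else 0 := by
  have hmap : ExteriorAlgebra.map (Finsupp.linearCombination (ZMod 3) fun p : ℕ × ℕ =>
      Finsupp.single (6 * p.2 + p.1) (1 : ZMod 3)) (mono l) =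
      (Finsupp.basisSingleOne (R := ZMod 3) (ι := ℕ)).ExteriorAlgebra l.toFinset := by
    have hcard : l.toFinset.card = l.length := List.toFinset_card_of_nodup hl.nodup
    have hemb : l.toFinset.orderEmbOfFin hcard = fun i => l.get i :=
      (Finset.orderEmbOfFin_unique hcard (fun i => by simp) hl.strictMono_get).symm
    rw [ExteriorAlgebra.basis_apply_ofCard _ hcard, ExteriorAlgebra.ιMulti_family,
      ExteriorAlgebra.ιMulti_apply, Set.powersetCard.ofFinEmbEquiv_symm_apply, mono, map_list_prod,
      List.map_map]
    congr 1
    apply List.ext_get (by simp)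
    intro i _ _
    have h (n : ℕ) : 6 * (n / 6) + n % 6 = n := Nat.div_add_mod n 6
    simp [letter, h, hemb, Set.powersetCard.ofCard]
  rw [coeff, LinearMap.comp_apply, AlgHom.toLinearMap_apply, hmap, Module.Basis.coord_apply,
    Module.Basis.repr_self, Finsupp.single_apply]

/-! ### A computable model -/

/-- Formal combinations, with coefficients in `ℕ`, of lists of letters. -/
abbrev Poly : Type := List (ℕ × List ℕ)

namespace Poly

/-- The element of the Grassmann algebra represented by a formal combination. -/
noncomputable def eval (p : Poly) : Gr := (p.map fun t => t.1 • mono t.2).sum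

@[simp] theorem eval_nil : eval [] = 0 := rfl

@[simp] theorem eval_cons (t : ℕ × List ℕ) (p : Poly) :
    eval (t :: p) = t.1 • mono t.2 + eval p := by simp [eval]

theorem eval_append (p q : Poly) : eval (p ++ q) = eval p + eval q := by simp [eval]

theorem nsmul_eq_mod (c : ℕ) (u : Gr) : c • u = (c % 3) • u := by
  rw [← Nat.cast_smul_eq_nsmul (ZMod 3), ← Nat.cast_smul_eq_nsmul (ZMod 3) (c % 3),
    ZMod.natCast_mod]

theorem two_nsmul_eq_neg (u : Gr) : 2 • u = -u := by
  rw [eq_neg_iff_add_eq_zero, ← succ_nsmul, nsmul_eq_mod]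
  exact zero_smul ℕ u

/-- Multiply a formal combination by a scalar. -/
def scale (c : ℕ) (p : Poly) : Poly := p.map fun t => (c * t.1, t.2)

theorem eval_scale (c : ℕ) (p : Poly) : eval (scale c p) = c • eval p := by
  induction p with
  | nil => simp [scale]
  | cons t p ih =>
    rw [scale, List.map_cons, eval_cons, eval_cons, ← scale, ih, smul_add, smul_smul]

/-- Prepend `c` times the product of the monomials `r.reverse`, `n` and `l` to `p`, where `l` is
increasing and `r` is decreasing with letters smaller than those of `l`. -/
def insertLetter (n : ℕ) (p : Poly) : ℕ → List ℕ → List ℕ → Poly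
  | c, r, [] => (c, r.reverseAux [n]) :: p
  | c, r, a :: l =>
    bif Nat.blt n a then (c, r.reverseAux (n :: a :: l)) :: p
    else bif Nat.beq n a then p
    else insertLetter n p (2 * c) (a :: r) l

theorem eval_insertLetter (n : ℕ) (p : Poly) (c : ℕ) (r l : List ℕ) :
    eval (insertLetter n p c r l) = c • (mono r.reverse * letter n * mono l) + eval p := by
  induction l generalizing c r with
  | nil => simp [insertLetter, List.reverseAux_eq, mono_append]
  | cons a l ih =>
    rw [insertLetter]
    cases h₁ : Nat.blt n a
    · cases h₂ : Nat.beq n a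
      · rw [cond_false, cond_false, ih, mul_comm, mul_smul, two_nsmul_eq_neg, List.reverse_cons,
          mono_append, mono_cons, mono_cons, mono_nil, mul_one, mul_assoc _ (letter a),
          letter_mul_swap a n]
        simp only [mul_neg, neg_mul, neg_neg, mul_assoc]
      · rw [cond_false, cond_true, Nat.eq_of_beq_eq_true h₂, mono_cons, mul_assoc,
          ← mul_assoc (letter a), letter_mul_self, zero_mul, mul_zero, smul_zero, zero_add]
    · rw [cond_true, eval_cons, List.reverseAux_eq, mono_append, mono_cons, mul_assoc]

/-- Multiply a formal combination by a letter on the left. -/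
def letterMul (n : ℕ) (p : Poly) : Poly :=
  p.foldr (fun t q => insertLetter n q t.1 [] t.2) []

theorem eval_letterMul (n : ℕ) (p : Poly) : eval (letterMul n p) = letter n * eval p := by
  induction p with
  | nil => simp [letterMul]
  | cons t p ih =>
    rw [letterMul, List.foldr_cons, eval_insertLetter, ← letterMul, ih, List.reverse_nil, mono_nil,
      one_mul, eval_cons, mul_add, mul_smul_comm]

/-- Multiply a formal combination by a monomial on the left. -/
def monoMul (l : List ℕ) (p : Poly) : Poly := l.foldr letterMul p

theorem eval_monoMul (l : List ℕ) (p : Poly) : eval (monoMul l p) = mono l * eval p := by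
  induction l with
  | nil => simp [monoMul]
  | cons n l ih =>
    rw [monoMul, List.foldr_cons, ← monoMul, eval_letterMul, ih, mono_cons, mul_assoc]

/-- The product of formal combinations. -/
def mul (p q : Poly) : Poly := p.flatMap fun t => scale t.1 (monoMul t.2 q)

theorem eval_mul (p q : Poly) : eval (mul p q) = eval p * eval q := by
  induction p with
  | nil => simp [mul]
  | cons t p ih =>
    rw [mul, List.flatMap_cons, eval_append, ← mul, ih, eval_scale, eval_monoMul, eval_cons,
      add_mul, smul_mul_assoc]

/-- The derivation with values `δ` on letters, applied to a monomial. -/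
def derivMono (δ : ℕ → ℕ × ℕ) : List ℕ → Poly
  | [] => []
  | n :: l => insertLetter (δ n).2 (letterMul n (derivMono δ l)) (δ n).1 [] l

/-- The derivation with values `δ` on letters. -/
def deriv (δ : ℕ → ℕ × ℕ) (p : Poly) : Poly := p.flatMap fun t => scale t.1 (derivMono δ t.2)

theorem eval_deriv {δ : ℕ → ℕ × ℕ} {D : Gr →ₗ[ZMod 3] Gr}
    (hD : ∀ u v : Gr, D (u * v) = D u * v + u * D v)
    (hδ : ∀ n, D (letter n) = (δ n).1 • letter (δ n).2) (p : Poly) :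
    eval (deriv δ p) = D (eval p) := by
  have hmono (l : List ℕ) : eval (derivMono δ l) = D (mono l) := by
    induction l with
    | nil => simp [derivMono, derivation_one hD]
    | cons n l ih =>
      rw [derivMono, eval_insertLetter, eval_letterMul, ih, mono_cons, hD, hδ, List.reverse_nil,
        mono_nil, one_mul, smul_mul_assoc]
  induction p with
  | nil => simp [deriv]
  | cons t p ih =>
    rw [deriv, List.flatMap_cons, eval_append, ← deriv, ih, eval_scale, hmono, eval_cons, map_add,
      map_nsmul]

/-- Boolean equality of lists of letters. -/
def sameLetters : List ℕ → List ℕ → Bool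
  | [], [] => true
  | a :: l, b :: m => bif Nat.beq a b then sameLetters l m else false
  | _, _ => false

theorem eq_of_sameLetters : ∀ {l m : List ℕ}, sameLetters l m = true → l = m
  | [], [], _ => rfl
  | a :: l, b :: m, h => by
    rw [sameLetters] at h
    cases hab : Nat.beq a b
    · simp [hab] at h
    · rw [hab, cond_true] at h
      rw [Nat.eq_of_beq_eq_true hab, eq_of_sameLetters h]

/-- Boolean test for lists of letters to be increasing. -/
def increasing : List ℕ → Bool
  | [] => true
  | [_] => true
  | a :: b :: l => bif Nat.blt a b then increasing (b :: l) else false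

theorem sortedLT_of_increasing {l : List ℕ} (h : increasing l = true) : l.SortedLT := by
  refine List.IsChain.sortedLT ?_
  induction l with
  | nil => simp
  | cons a l ih =>
    cases l with
    | nil => simp
    | cons b l =>
      rw [increasing] at h
      cases hab : Nat.blt a b
      · simp [hab] at h
      · rw [hab, cond_true] at h
        exact List.isChain_cons_cons.mpr ⟨by simpa using hab, ih h⟩

/-- An encoding of lists of letters as natural numbers. -/
def code : List ℕ → ℕ
  | [] => 0
  | n :: l => 32 * code l + n + 1

/-- Add a term to a formal combination, merging it with a term with the same letters. -/
def addTerm (t : ℕ × List ℕ) : Poly → Poly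
  | [] => [t]
  | u :: p => bif sameLetters t.2 u.2 then (t.1 + u.1, u.2) :: p else u :: addTerm t p

theorem eval_addTerm (t : ℕ × List ℕ) (p : Poly) :
    eval (addTerm t p) = t.1 • mono t.2 + eval p := by
  induction p with
  | nil => simp [addTerm]
  | cons u p ih =>
    rw [addTerm]
    cases h : sameLetters t.2 u.2
    · rw [cond_false, eval_cons, ih, eval_cons, add_left_comm]
    · rw [cond_true, eval_cons, eval_cons, eq_of_sameLetters h, add_smul, add_assoc]

/-- Reduce the coefficients modulo `3` and drop the terms with coefficient zero. -/
def reduce : Poly → Poly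
  | [] => []
  | t :: p => bif Nat.beq (t.1 % 3) 0 then reduce p else (t.1 % 3, t.2) :: reduce p

theorem eval_reduce (p : Poly) : eval (reduce p) = eval p := by
  induction p with
  | nil => rfl
  | cons t p ih =>
    rw [reduce, eval_cons, nsmul_eq_mod]
    cases h : Nat.beq (t.1 % 3) 0
    · rw [cond_false, eval_cons, ih]
    · rw [cond_true, Nat.eq_of_beq_eq_true h, zero_smul, zero_add, ih]

/-- Collect equal monomials, and reduce the coefficients modulo `3`. -/
def normalize (p : Poly) : Poly := reduce (p.foldr addTerm [])

theorem eval_normalize (p : Poly) : eval (normalize p) = eval p := by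
  rw [normalize, eval_reduce]
  induction p with
  | nil => rfl
  | cons t p ih => rw [List.foldr_cons, eval_addTerm, ih, eval_cons]

/-- The polynomial `p` is a combination of increasing monomials, exactly one of which has its code
among `ks`, namely the monomial `k`. -/
def isDualTo (ks : List ℕ) (k : List ℕ) (p : Poly) : Bool :=
  p.all (fun t => increasing t.2) &&
    match p.filter fun t => ks.any (Nat.beq (code t.2)) with
    | [t] => sameLetters t.2 k && (Nat.beq t.1 1 || Nat.beq t.1 2)
    | _ => false

/-- Each polynomial in the list is a combination of increasing monomials, exactly one of which has
the code of the key of a member of the list, namely the key of that polynomial. -/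
def IsDual (L : List (List ℕ × Poly)) : Prop :=
  L.all (fun q => isDualTo (L.map fun r => code r.1) q.1 q.2) = true

theorem coeff_toFinset_mono {k l : List ℕ} (hk : k.SortedLT) (hl : l.SortedLT) :
    coeff k.toFinset (mono l) = if l = k then 1 else 0 := by
  rw [coeff_mono hl]
  congr 1
  refine propext ⟨fun h => hl.eq_of_mem_iff hk fun a => ?_, congrArg _⟩
  rw [← List.mem_toFinset, h, List.mem_toFinset]

theorem coeff_eval_filter {p : Poly} (hp : ∀ t ∈ p, t.2.SortedLT) {P : List ℕ → Bool}
    {k : List ℕ} (hk : k.SortedLT) (hP : P k = true) :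
    coeff k.toFinset (eval (p.filter fun t => P t.2)) = coeff k.toFinset (eval p) := by
  induction p with
  | nil => rfl
  | cons t p ih =>
    have ih := ih fun t ht => hp t (List.mem_cons_of_mem _ ht)
    rw [eval_cons, map_add, map_nsmul, coeff_toFinset_mono hk (hp t List.mem_cons_self), ← ih]
    by_cases ht : P t.2 = true
    · rw [List.filter_cons, if_pos ht, eval_cons, map_add, map_nsmul,
        coeff_toFinset_mono hk (hp t List.mem_cons_self)]
    · rw [List.filter_cons, if_neg ht, if_neg (by rintro rfl; exact ht hP), smul_zero, zero_add]

theorem exists_filter_of_isDualTo {ks : List ℕ} {k : List ℕ} {p : Poly}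
    (h : isDualTo ks k p = true) : (∀ t ∈ p, t.2.SortedLT) ∧ k.SortedLT ∧
      ∃ c : ℕ, (c : ZMod 3) * c = 1 ∧
        p.filter (fun t => ks.any (Nat.beq (code t.2))) = [(c, k)] := by
  rw [isDualTo, Bool.and_eq_true, List.all_eq_true] at h
  obtain ⟨hp, h⟩ := h
  split at h
  next t ht =>
    simp only [Bool.and_eq_true, Bool.or_eq_true] at h
    have hk := eq_of_sameLetters h.1
    have hmem : t ∈ p := List.mem_of_mem_filter (ht ▸ List.mem_singleton_self t)
    refine ⟨fun t ht => sortedLT_of_increasing (hp t ht), hk ▸ sortedLT_of_increasing (hp t hmem),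
      t.1, ?_, by rw [ht, ← hk]⟩
    rcases h.2 with h | h <;> rw [Nat.eq_of_beq_eq_true h] <;> decide
  next => exact absurd h (by simp)

theorem IsDual.linearIndependent {L : List (List ℕ × Poly)} (hL : IsDual L)
    (hnodup : (L.map fun q => code q.1).Nodup) :
    LinearIndependent (ZMod 3) fun i : Fin L.length => eval (L.get i).2 := by
  have hL (i : Fin L.length) :=
    exists_filter_of_isDualTo (List.all_eq_true.mp hL _ (L.get_mem i))
  have hinj {i j : Fin L.length} (h : (L.get i).1 = (L.get j).1) : i = j := by
    have := List.nodup_iff_injective_get.mp hnodup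
      (a₁ := i.cast (List.length_map _).symm) (a₂ := j.cast (List.length_map _).symm)
      (by simpa using congrArg code h)
    simpa [Fin.ext_iff] using this
  choose hs hk c hc hf using hL
  have hcoeff (i j : Fin L.length) :
      coeff (L.get j).1.toFinset (eval (L.get i).2) = (c i : ZMod 3) * if i = j then 1 else 0 := by
    have hj : (L.map fun r => code r.1).any (Nat.beq (code (L.get j).1)) = true :=
      List.any_eq_true.mpr ⟨_, List.mem_map_of_mem (L.get_mem j), Nat.beq_refl _⟩
    rw [← coeff_eval_filter (P := fun l => (L.map fun r => code r.1).any (Nat.beq (code l)))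
        (hs i) (hk j) hj, hf i, eval_cons, eval_nil, add_zero, map_nsmul,
      coeff_toFinset_mono (hk j) (hk i), nsmul_eq_mul]
    congr 2
    exact propext ⟨hinj, fun h => h ▸ rfl⟩
  refine LinearIndependent.of_pairwise_dual_eq_zero_one _
    (fun i => (c i : ZMod 3) • coeff (L.get i).1.toFinset) (fun i j hij => ?_) fun i => ?_
  · change ((c i : ZMod 3) • coeff (L.get i).1.toFinset) (L.get j).2.eval = 0
    rw [LinearMap.smul_apply, hcoeff, if_neg hij.symm, mul_zero, smul_zero]
  · rw [LinearMap.smul_apply, hcoeff, if_pos rfl, mul_one, smul_eq_mul, hc]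

end Poly

/-! ### Ternary words -/

/-- Expressions in the generators built from sums, differences and the ternary operation. -/
inductive Word : Type
  | gen (i : ℕ)
  | add (u v : Word)
  | sub (u v : Word)
  | bracket (u v w : Word)

namespace Word

/-- The value of a word for the derivation `d`. -/
noncomputable def eval (d : Gr →ₗ[ZMod 3] Gr) : Word → Gr
  | gen i => g (i % 6)
  | add u v => u.eval d + v.eval d
  | sub u v => u.eval d - v.eval d
  | bracket u v w => -d (u.eval d * v.eval d * w.eval d)

/-- The value of a word in the computable model. -/
def poly : Word → Poly
  | gen i => [(1, [i % 6])]
  | add u v => (u.poly ++ v.poly).normalize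
  | sub u v => (u.poly ++ v.poly.scale 2).normalize
  | bracket u v w =>
    ((((u.poly.mul v.poly).mul w.poly).normalize.deriv fun n => (1, n + 6)).scale 2).normalize

theorem eval_mem {d : Gr →ₗ[ZMod 3] Gr} {p : Submodule (ZMod 3) Gr} (hg : ∀ i < 6, g i ∈ p)
    (hT : ∀ x y z : Gr, x ∈ p → y ∈ p → z ∈ p → -d (x * y * z) ∈ p) (w : Word) :
    w.eval d ∈ p := by
  induction w with
  | gen i => exact hg _ (Nat.mod_lt _ (by norm_num))
  | add u v hu hv => exact add_mem hu hv
  | sub u v hu hv => exact sub_mem hu hv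
  | bracket u v w hu hv hw => exact hT _ _ _ hu hv hw

theorem eval_poly {d : Gr →ₗ[ZMod 3] Gr}
    (hLeib : ∀ u v : Gr, d (u * v) = d u * v + u * d v)
    (hd : ∀ n, d (letter n) = letter (n + 6)) (w : Word) : w.poly.eval = w.eval d := by
  induction w with
  | gen i => simp [poly, eval, letter, Nat.div_eq_of_lt (Nat.mod_lt i (by norm_num : 0 < 6))]
  | add u v hu hv => rw [poly, eval, Poly.eval_normalize, Poly.eval_append, hu, hv]
  | sub u v hu hv =>
    rw [poly, eval, Poly.eval_normalize, Poly.eval_append, Poly.eval_scale, hu, hv,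
      Poly.two_nsmul_eq_neg, sub_eq_add_neg]
  | bracket u v w hu hv hw =>
    rw [poly, eval, Poly.eval_normalize, Poly.eval_scale,
      Poly.eval_deriv hLeib (fun n => by rw [hd, one_smul]), Poly.eval_normalize, Poly.eval_mul,
      Poly.eval_mul, hu, hv, hw, Poly.two_nsmul_eq_neg]

/-- The ternary operation on generators. -/
def brGen (a b : ℕ) (w : Word) : Word := bracket (gen a) (gen b) w

/-- The image under `d` of `± x' a u v w ∓ x a' u v w`. -/
def exchange (x a u v w : ℕ) : Word :=
  add (brGen a w (brGen x u (gen v))) (brGen x w (brGen a u (gen v)))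

/-- Sublists of length `k`. -/
def choose : ℕ → List ℕ → List (List ℕ)
  | 0, _ => [[]]
  | _ + 1, [] => []
  | k + 1, a :: l => (choose k l).map (a :: ·) ++ choose (k + 1) l

/-- All pairs consisting of a subset of `s` of size `k` and its complement in `s`. -/
def splits (k : ℕ) (s : List ℕ) : List (List ℕ × List ℕ) :=
  (choose k s).map fun t => (t, s.filter fun a => decide (a ∉ t))

/-- The words attached to a set of `k` indices occurring twice and a set of `m` indices occurring
once. Each comes with the monomial that distinguishes it from the others. -/
def ofContent : List ℕ → List ℕ → List (List ℕ × Word)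
  | [], [a] => [([a], gen a)]
  | [], [a, b, c] => [([a + 6, b, c], brGen a b (gen c))]
  | [a], [b, c, e] => [([a, a + 12, b, c, e], brGen a e (brGen a b (gen c)))]
  | [], [a, b, c, e, f] =>
    [([a, b + 12, c, e, f], exchange b a c e f), ([a, b, c + 12, e, f], exchange c a b e f),
      ([a, b, c, e + 12, f], exchange e a b c f), ([a, b, c, e, f + 12], exchange f a b c e)]
  | [a, b], [c, e, f] =>
    [([a, a + 12, b, b + 6, c, e, f], brGen a b (brGen a c (brGen b e (gen f))))]
  | [a], [b, c, e, f, h] =>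
    [([a, a + 6, b, c + 12, e, f, h], brGen a h (exchange c b e f a)),
      ([a, a + 6, b, c, e + 12, f, h], brGen a h (exchange e b c f a)),
      ([a, a + 6, b, c, e, f + 12, h], brGen a h (exchange f b c e a)),
      ([a, a + 6, b, c, e, f, h + 12], brGen a f (exchange h b c e a)),
      ([a, a + 18, b, c, e, f, h],
        sub (add (brGen f h (brGen a e (brGen a b (gen c)))) (brGen a h (exchange c b e f a)))
          (brGen a h (exchange e b c f a)))]
  | [a, b, c], [e, f, h] =>
    [([a, a + 12, b, b + 6, c, c + 6, e, f, h],
      brGen a b (brGen a c (brGen b e (brGen c f (gen h)))))]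
  | _, _ => []

/-- A list of words whose values form a basis. -/
def basis : List (List ℕ × Word) :=
  [(0, 1), (0, 3), (1, 4), (0, 5), (2, 5), (1, 6), (3, 6)].flatMap fun km =>
    (choose km.2 (List.range 6)).flatMap fun s =>
      (splits km.1 s).flatMap fun st =>
        (ofContent st.1 st.2).map fun q => ((Poly.monoMul q.1 [(1, [])]).flatMap Prod.snd, q.2)

theorem basis_isDual : Poly.IsDual (basis.map fun q => (q.1, q.2.poly)) := by
  rw [Poly.IsDual]
  decide +kernel

theorem basis_keys_nodup :
    ((basis.map fun q => (q.1, q.2.poly)).map fun q => Poly.code q.1).Nodup := by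
  decide +kernel

end Word

/-! ### Dimensions of homogeneous components -/

/-- The decreasing lists of `k` letters less than `N` with total order `s`. -/
def monos : ℕ → ℕ → ℕ → List (List ℕ)
  | 0, k, s => if k = 0 ∧ s = 0 then [[]] else []
  | N + 1, k, s => monos N k s ++
      if 1 ≤ k ∧ N / 6 ≤ s then (monos N (k - 1) (s - N / 6)).map (N :: ·) else []

theorem mem_monos (N : ℕ) : ∀ {l : List ℕ}, l.SortedGT → (∀ n ∈ l, n < N) →
    l ∈ monos N l.length (order l) := by
  induction N with
  | zero =>
    intro l _ hN
    obtain rfl : l = [] := List.eq_nil_iff_forall_not_mem.mpr fun n hn => by simpa using hN n hn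
    simp [monos]
  | succ N ih =>
    intro l hl hN
    rw [monos, List.mem_append]
    match l with
    | [] => exact .inl (ih hl (by simp))
    | a :: l =>
      have hp := List.pairwise_cons.mp hl.pairwise
      rcases (Nat.lt_succ_iff.mp (hN a List.mem_cons_self)).lt_or_eq with ha | rfl
      · refine .inl (ih hl fun n hn => ?_)
        rcases List.mem_cons.mp hn with rfl | hn
        · exact ha
        · exact (hp.1 n hn).trans ha
      · right
        simp [ih hp.2.sortedGT hp.1]

theorem div_six_le_order {n : ℕ} {l : List ℕ} (hn : n ∈ l) : n / 6 ≤ order l :=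
  List.single_le_sum (by simp) _ (List.mem_map_of_mem hn)

theorem homogeneous_le_span_monos {k s N : ℕ} (hN : 6 * (s + 1) ≤ N) :
    homogeneous k s ≤ Submodule.span (ZMod 3) (Set.range fun i => mono ((monos N k s).get i)) := by
  rw [homogeneous, Submodule.span_le]
  rintro _ ⟨l, ⟨rfl, rfl⟩, rfl⟩
  by_cases hl : l.Nodup
  · have hperm := l.mergeSort_perm (· ≥ ·)
    have hmem : l.mergeSort (· ≥ ·) ∈ monos N l.length (order l) := by
      have horder : order (l.mergeSort (· ≥ ·)) = order l := (hperm.map _).sum_eq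
      rw [← hperm.length_eq, ← horder]
      refine mem_monos N ?_ fun n hn => ?_
      · exact List.sortedGE_mergeSort.sortedGT_of_nodup (hperm.nodup_iff.mpr hl)
      · have := div_six_le_order (hperm.mem_iff.mp hn)
        omega
    have hspan : mono (l.mergeSort (· ≥ ·)) ∈
        Submodule.span (ZMod 3) (Set.range fun i => mono ((monos N l.length (order l)).get i)) := by
      obtain ⟨i, hi⟩ := List.get_of_mem hmem
      exact Submodule.subset_span ⟨i, congrArg mono hi⟩
    rcases mono_perm hperm.symm with h | h <;> rw [SetLike.mem_coe, h]
    · exact hspan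
    · exact neg_mem hspan
  · rw [SetLike.mem_coe, mono_eq_zero_of_not_nodup hl]
    exact zero_mem _

instance finite_homogeneous (k s : ℕ) : Module.Finite (ZMod 3) (homogeneous k s) :=
  have := FiniteDimensional.span_of_finite (ZMod 3)
    (Set.finite_range fun i => mono ((monos (6 * (s + 1)) k s).get i))
  Submodule.finiteDimensional_of_le (homogeneous_le_span_monos le_rfl)

theorem finrank_homogeneous_le {k s N : ℕ} (hN : 6 * (s + 1) ≤ N) :
    Module.finrank (ZMod 3) (homogeneous k s) ≤ (monos N k s).length := by
  have := FiniteDimensional.span_of_finite (ZMod 3)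
    (Set.finite_range fun i => mono ((monos N k s).get i))
  refine (Submodule.finrank_mono (homogeneous_le_span_monos hN)).trans ?_
  exact (finrank_range_le_card _).trans (Fintype.card_fin _).le

theorem length_le_of_nodup {l : List ℕ} (hl : l.Nodup) : l.length ≤ 6 + order l := by
  have h₁ : (l.filter (· < 6)).length ≤ 6 := by
    rw [← List.toFinset_card_of_nodup (hl.filter _)]
    refine (Finset.card_le_card (t := Finset.range 6) fun n hn => ?_).trans (by simp)
    simpa using (List.mem_filter.mp (List.mem_toFinset.mp hn)).2
  have h₂ : l.length ≤ (l.filter (· < 6)).length + order l := by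
    clear h₁ hl
    induction l with
    | nil => simp
    | cons n l ih =>
      rw [List.filter_cons, List.length_cons, order_cons]
      split_ifs with h
      · rw [List.length_cons]
        omega
      · have : ¬n < 6 := by simpa using h
        omega
  omega

theorem homogeneous_eq_bot {k s : ℕ} (h : 6 + s < k) : homogeneous k s = ⊥ := by
  rw [homogeneous, Submodule.span_eq_bot]
  rintro _ ⟨l, ⟨rfl, rfl⟩, rfl⟩
  exact mono_eq_zero_of_not_nodup fun hl => absurd (length_le_of_nodup hl) (by omega)

/-! ### The kernel of the lowering derivation -/

/-- The homogeneous elements annihilated by `E`. -/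
noncomputable def primitive (E : Gr →ₗ[ZMod 3] Gr) (k s : ℕ) : Submodule (ZMod 3) Gr :=
  homogeneous k s ⊓ LinearMap.ker E

instance finite_primitive (E : Gr →ₗ[ZMod 3] Gr) (k s : ℕ) :
    Module.Finite (ZMod 3) (primitive E k s) :=
  Submodule.finiteDimensional_of_le inf_le_left

theorem primitive_mul_le {E : Gr →ₗ[ZMod 3] Gr} (hE : ∀ u v : Gr, E (u * v) = E u * v + u * E v)
    (k s k' s' : ℕ) : primitive E k s * primitive E k' s' ≤ primitive E (k + k') (s + s') := by
  refine Submodule.mul_le.mpr fun u hu v hv => ⟨?_, ?_⟩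
  · exact homogeneous_mul_le _ _ _ _ (Submodule.mul_mem_mul hu.1 hv.1)
  · rw [SetLike.mem_coe, LinearMap.mem_ker, hE, LinearMap.mem_ker.mp hu.2,
      LinearMap.mem_ker.mp hv.2, zero_mul, mul_zero, add_zero]

theorem finrank_inf_ker_add_le {K V : Type*} [Field K] [AddCommGroup V] [Module K V]
    (H : Submodule K V) [Module.Finite K H] (f : V →ₗ[K] V) {ι : Type*} [Fintype ι] {u : ι → V}
    (hu : ∀ i, u i ∈ H) (hf : LinearIndependent K fun i => f (u i)) :
    Module.finrank K ↥(H ⊓ LinearMap.ker f) + Fintype.card ι ≤ Module.finrank K H := by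
  have hker : Module.finrank K ↥(H ⊓ LinearMap.ker f) =
      Module.finrank K (LinearMap.ker (f.domRestrict H)) := by
    rw [LinearMap.ker_domRestrict, ← Submodule.finrank_map_subtype_eq H,
      Submodule.map_comap_subtype]
  have hrange : Fintype.card ι ≤ Module.finrank K (LinearMap.range (f.domRestrict H)) := by
    rw [← finrank_span_eq_card hf]
    refine Submodule.finrank_mono (Submodule.span_le.mpr ?_)
    rintro _ ⟨i, rfl⟩
    exact ⟨⟨u i, hu i⟩, rfl⟩
  have := (f.domRestrict H).finrank_range_add_finrank_ker
  omega

/-- The lowering derivation on letters, in the computable model. -/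
def lower (n : ℕ) : ℕ × ℕ := (n / 6 * (2 + 2 * (n / 6)), n - 6)

theorem finrank_primitive_add_le {E : Gr →ₗ[ZMod 3] Gr}
    (hE : ∀ u v : Gr, E (u * v) = E u * v + u * E v)
    (hEl : ∀ n, E (letter n) = ((n / 6 : ℕ) * (2 - (n / 6 : ℕ)) : ZMod 3) • letter (n - 6))
    {k s N : ℕ} (hN : 6 * (s + 1) ≤ N) (L : List (List ℕ × List ℕ))
    (hL : ∀ q ∈ L, q.2.length = k ∧ order q.2 = s)
    (hdual : Poly.IsDual (L.map fun q => (q.1, ((Poly.deriv lower [(1, q.2)]).normalize))))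
    (hnodup : ((L.map fun q =>
      (q.1, ((Poly.deriv lower [(1, q.2)]).normalize))).map fun q => Poly.code q.1).Nodup) :
    Module.finrank (ZMod 3) (primitive E k s) + L.length ≤ (monos N k s).length := by
  have hli := hdual.linearIndependent hnodup
  have hlower (n : ℕ) : E (letter n) = (lower n).1 • letter (lower n).2 := by
    rw [hEl, lower, ← Nat.cast_smul_eq_nsmul (ZMod 3)]
    congr 1
    push_cast
    linear_combination (-(n / 6 : ℕ) ^ 2 : ZMod 3) * (by decide : (3 : ZMod 3) = 0)
  have := finrank_inf_ker_add_le (homogeneous k s) E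
    (u := fun i : Fin (L.map fun q =>
      (q.1, ((Poly.deriv lower [(1, q.2)]).normalize))).length =>
        mono (L.get (i.cast (List.length_map _))).2)
    (fun i => Submodule.subset_span ⟨_, hL _ (L.get_mem _), rfl⟩)
    (by
      convert hli using 2 with i
      · simp [Poly.eval_normalize, Poly.eval_deriv hE hlower]
      · rfl)
  rw [Fintype.card_fin, List.length_map] at this
  exact this.trans (finrank_homogeneous_le hN)

theorem finrank_primitive_five_one {E : Gr →ₗ[ZMod 3] Gr}
    (hE : ∀ u v : Gr, E (u * v) = E u * v + u * E v)
    (hEl : ∀ n, E (letter n) = ((n / 6 : ℕ) * (2 - (n / 6 : ℕ)) : ZMod 3) • letter (n - 6)) :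
    Module.finrank (ZMod 3) (primitive E 5 1) ≤ 84 := by
  have := finrank_primitive_add_le hE hEl (k := 5) (s := 1) (N := 12) le_rfl
    ((List.range 6).map fun i => ((List.range 6).erase i,
      ((List.range 6).erase i).erase ((i + 1) % 6) ++ [(i + 1) % 6 + 6]))
    (by decide) (by rw [Poly.IsDual]; decide +kernel) (by decide +kernel)
  have hlen : (monos 12 5 1).length = 90 := by decide +kernel
  rw [hlen, List.length_map, List.length_range] at this
  omega

theorem finrank_primitive_seven_two {E : Gr →ₗ[ZMod 3] Gr}
    (hE : ∀ u v : Gr, E (u * v) = E u * v + u * E v)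
    (hEl : ∀ n, E (letter n) = ((n / 6 : ℕ) * (2 - (n / 6 : ℕ)) : ZMod 3) • letter (n - 6)) :
    Module.finrank (ZMod 3) (primitive E 7 2) ≤ 90 := by
  have := finrank_primitive_add_le hE hEl (k := 7) (s := 2) (N := 18) le_rfl
    ((List.range 6).map fun i =>
      (List.range 6 ++ [i + 6],
        (List.range 6).erase ((i + 1) % 6) ++ [min i ((i + 1) % 6) + 6, max i ((i + 1) % 6) + 6]))
    (by decide) (by rw [Poly.IsDual]; decide +kernel) (by decide +kernel)
  have hlen : (monos 18 7 2).length = 96 := by decide +kernel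
  rw [hlen, List.length_map, List.length_range] at this
  omega

theorem finrank_primitive_le {E : Gr →ₗ[ZMod 3] Gr} {k s N : ℕ} (hN : 6 * (s + 1) ≤ N) :
    Module.finrank (ZMod 3) (primitive E k s) ≤ (monos N k s).length :=
  (Submodule.finrank_mono inf_le_left).trans (finrank_homogeneous_le hN)

/-! ### The upper bound -/

theorem finrank_sup_le {K V : Type*} [Field K] [AddCommGroup V] [Module K V]
    {U W : Submodule K V} [Module.Finite K U] [Module.Finite K W] {a b : ℕ}
    (hU : Module.finrank K U ≤ a) (hW : Module.finrank K W ≤ b) :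
    Module.finrank K ↥(U ⊔ W) ≤ a + b :=
  (Submodule.finrank_add_le_finrank_add_finrank U W).trans (add_le_add hU hW)

theorem iSup_primitive_le (E : Gr →ₗ[ZMod 3] Gr) :
    ⨆ m, primitive E (2 * m + 3) m ≤
      primitive E 3 0 ⊔ primitive E 5 1 ⊔ primitive E 7 2 ⊔ primitive E 9 3 := by
  refine iSup_le fun m => ?_
  rcases lt_or_ge m 4 with hm | hm
  · interval_cases m
    · exact le_sup_of_le_left (le_sup_of_le_left le_sup_left)
    · exact le_sup_of_le_left (le_sup_of_le_left le_sup_right)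
    · exact le_sup_of_le_left le_sup_right
    · exact le_sup_right
  · rw [primitive, homogeneous_eq_bot (by omega), bot_inf_eq]
    exact bot_le

theorem iSup_primitive_mul_le {E : Gr →ₗ[ZMod 3] Gr}
    (hE : ∀ u v : Gr, E (u * v) = E u * v + u * E v) :
    (⨆ m, primitive E (2 * m + 1) m) * (⨆ m, primitive E (2 * m + 1) m) *
      (⨆ m, primitive E (2 * m + 1) m) ≤ ⨆ m, primitive E (2 * m + 3) m := by
  simp only [Submodule.iSup_mul, Submodule.mul_iSup]
  refine iSup_le fun a => iSup_le fun b => iSup_le fun c => ?_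
  refine le_trans ?_ (le_iSup (fun m => primitive E (2 * m + 3) m) (a + b + c))
  refine (mul_le_mul' (primitive_mul_le hE _ _ _ _) le_rfl).trans
    ((primitive_mul_le hE _ _ _ _).trans (le_of_eq ?_))
  congr 1 <;> ring

/-- A finite-dimensional subspace containing the generators and closed under the operation. -/
theorem exists_closed_subspace {d : Gr →ₗ[ZMod 3] Gr}
    (hLeib : ∀ u v : Gr, d (u * v) = d u * v + u * d v)
    (hd : ∀ n, d (letter n) = letter (n + 6)) :
    ∃ W : Submodule (ZMod 3) Gr, Module.Finite (ZMod 3) W ∧ Module.finrank (ZMod 3) W ≤ 220 ∧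
      (∀ i < 6, g i ∈ W) ∧ ∀ x y z : Gr, x ∈ W → y ∈ W → z ∈ W → -d (x * y * z) ∈ W := by
  obtain ⟨E, hE, hEl⟩ := exists_lowering
  let S := primitive E 3 0 ⊔ primitive E 5 1 ⊔ primitive E 7 2 ⊔ primitive E 9 3
  let W := primitive E 1 0 ⊔ S.map d
  have hraise (m : ℕ) {u : Gr} (hu : u ∈ primitive E (2 * m + 3) m) :
      d u ∈ primitive E (2 * (m + 1) + 1) (m + 1) := by
    refine ⟨derivation_mem_homogeneous hLeib hd hu.1, ?_⟩
    rw [SetLike.mem_coe, LinearMap.mem_ker, lowering_comp_derivation hLeib hd hE hEl hu.1,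
      LinearMap.mem_ker.mp hu.2, map_zero, zero_add]
    have : ((2 * m + 3 : ℕ) : ZMod 3) - 2 * m = 0 := by
      push_cast
      linear_combination (by decide : (3 : ZMod 3) = 0)
    rw [this, zero_smul]
  have hW : W ≤ ⨆ m, primitive E (2 * m + 1) m := by
    have h (m : ℕ) : (primitive E (2 * m + 3) m).map d ≤ ⨆ m, primitive E (2 * m + 1) m :=
      Submodule.map_le_iff_le_comap.mpr fun u hu =>
        le_iSup (fun m => primitive E (2 * m + 1) m) (m + 1) (hraise m hu)
    refine sup_le (le_iSup (fun m => primitive E (2 * m + 1) m) 0) ?_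
    simp only [S, Submodule.map_sup]
    exact sup_le (sup_le (sup_le (h 0) (h 1)) (h 2)) (h 3)
  refine ⟨W, inferInstance, ?_, fun i hi => ?_, fun x y z hx hy hz => ?_⟩
  · have h₁ : (monos 6 1 0).length = 6 := by decide +kernel
    have h₃ : (monos 6 3 0).length = 20 := by decide +kernel
    have h₉ : (monos 24 9 3).length = 20 := by decide +kernel
    have hS : Module.finrank (ZMod 3) S ≤ 20 + 84 + 90 + 20 :=
      finrank_sup_le (finrank_sup_le (finrank_sup_le
        ((finrank_primitive_le (N := 6) le_rfl).trans_eq h₃)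
        (finrank_primitive_five_one hE hEl)) (finrank_primitive_seven_two hE hEl))
        ((finrank_primitive_le (N := 24) le_rfl).trans_eq h₉)
    exact finrank_sup_le (a := 6) (b := 214) ((finrank_primitive_le (N := 6) le_rfl).trans_eq h₁)
      ((Submodule.finrank_map_le d S).trans hS)
  · refine le_sup_left (a := primitive E 1 0) ⟨?_, ?_⟩
    · simpa [letter, Nat.mod_eq_of_lt hi, Nat.div_eq_of_lt hi] using mono_mem_homogeneous [i]
    · simpa [letter, Nat.mod_eq_of_lt hi, Nat.div_eq_of_lt hi] using hEl i
  · refine neg_mem (le_sup_right (a := primitive E 1 0) (Submodule.mem_map_of_mem ?_))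
    exact iSup_primitive_le E (iSup_primitive_mul_le hE
      (Submodule.mul_mem_mul (Submodule.mul_mem_mul (hW hx) (hW hy)) (hW hz)))

end Grassmann

open Grassmann in
/-- with `d` the derivation of `Gr` sending `ι(e_{i,j})` to
`ι(e_{i,j+1})` and `T x y z = -d (x*y*z)`, the smallest `𝔽₃`-subspace of `Gr`
containing `g₀, …, g_{5}` and closed under `T` has dimension `220`. -/
theorem stmt_4 (d : Gr →ₗ[ZMod 3] Gr)
    (hLeib : ∀ u v : Gr, d (u * v) = d u * v + u * d v)
    (hd : ∀ i j : ℕ, d (gen i j) = gen i (j + 1)) :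
    Module.finrank (ZMod 3)
      ↥(sInf {p : Submodule (ZMod 3) Gr |
          (∀ i < 6, g i ∈ p) ∧
          ∀ x y z : Gr, x ∈ p → y ∈ p → z ∈ p → -d (x * y * z) ∈ p}) = 220 := by
  have hletter (n : ℕ) : d (letter n) = letter (n + 6) := by
    rw [letter, hd, letter, Nat.add_mod_right, Nat.add_div_right n (by norm_num)]
  obtain ⟨W, hfin, hrank, hW⟩ := exists_closed_subspace hLeib hletter
  have hle := sInf_le (a := W) (s := {p : Submodule (ZMod 3) Gr | (∀ i < 6, g i ∈ p) ∧
    ∀ x y z : Gr, x ∈ p → y ∈ p → z ∈ p → -d (x * y * z) ∈ p}) hW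
  refine le_antisymm ((Submodule.finrank_mono hle).trans hrank) ?_
  have := Submodule.finiteDimensional_of_le hle
  have hli := Word.basis_isDual.linearIndependent Word.basis_keys_nodup
  have hlen : (Word.basis.map fun q => (q.1, q.2.poly)).length = 220 := by
    rw [List.length_map]
    decide +kernel
  rw [← hlen, ← Fintype.card_fin (Word.basis.map fun q => (q.1, q.2.poly)).length,
    ← finrank_span_eq_card hli]
  refine Submodule.finrank_mono (Submodule.span_le.mpr ?_)
  rintro _ ⟨i, rfl⟩
  refine Submodule.mem_sInf.mpr fun p hp => ?_
  have := (Word.basis.get (i.cast (List.length_map _))).2.eval_mem hp.1 hp.2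
  simpa [← Word.eval_poly hLeib hletter] using this
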